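/- arXiv:1612.08923 — 3 statements merged into one kernel-verified Lean document; each statement's English description precedes it below -/
import Mathlib

section
/- For every p ∈ (0,1), 2√p / (1 + √p) = 1 - ∑_{k=1}^∞ c_k (1-p)^k, where c_k = 2 c'_{k+1} with c'_m = binomial(2m-2, m-1) / (2^{2m-1} m). Moreover all c_k are nonnegative and ∑_{k=1}^∞ c_k = 1. -/
/-- The `m`-th coefficient of the expansion `1 - √(1-p) = ∑_{m≥1} c'_m p^m`:
`c'_m = binomial(2m-2, m-1) / (2^{2m-1} m)`. -/
noncomputable def sqrtCoeff (m : ℕ) : ℝ :=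
  (Nat.choose (2 * m - 2) (m - 1) : ℝ) / (2 ^ (2 * m - 1) * m)

theorem sqrtCoeff_succ (n : ℕ) : 2 * sqrtCoeff (n + 1) = catalan n / 4 ^ n := by
  have h : ((n : ℝ) + 1) * catalan n = (2 * n).choose n := by
    exact_mod_cast (succ_mul_catalan_eq_centralBinom n).trans (Nat.centralBinom_eq_two_mul_choose n)
  have e₁ : 2 * (n + 1) - 2 = 2 * n := by omega
  have e₂ : 2 * (n + 1) - 1 = 2 * n + 1 := by omega
  rw [sqrtCoeff, e₁, e₂, Nat.add_sub_cancel, ← h, pow_succ, pow_mul]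
  push_cast
  norm_num
  field_simp

theorem sum_range_catalan_div_four_pow (n : ℕ) :
    ∑ k ∈ Finset.range n, (catalan k : ℝ) / 4 ^ k = 2 - 2 * (n.centralBinom / 4 ^ n) := by
  induction n with
  | zero => simp
  | succ n ih =>
    have h₁ : ((n : ℝ) + 1) * catalan n = n.centralBinom := by
      exact_mod_cast succ_mul_catalan_eq_centralBinom n
    have h₂ : ((n : ℝ) + 1) * (n + 1).centralBinom = 2 * (2 * n + 1) * n.centralBinom := by
      exact_mod_cast Nat.succ_mul_centralBinom_succ n
    have h₃ : ((n + 1).centralBinom : ℝ) = 2 * (2 * n + 1) * catalan n := by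
      have hn : (n : ℝ) + 1 ≠ 0 := by positivity
      apply mul_left_cancel₀ hn
      rw [h₂, ← h₁]
      ring
    rw [Finset.sum_range_succ, ih, h₃, ← h₁, pow_succ]
    field_simp
    ring

theorem centralBinom_div_four_pow_sq_le (n : ℕ) :
    ((n.centralBinom : ℝ) / 4 ^ n) ^ 2 ≤ 1 / (2 * n + 1) := by
  induction n with
  | zero => simp
  | succ n ih =>
    have h : ((n + 1).centralBinom : ℝ) / 4 ^ (n + 1) =
        (2 * n + 1) / (2 * (n + 1)) * (n.centralBinom / 4 ^ n) := by
      have h₂ : ((n : ℝ) + 1) * (n + 1).centralBinom = 2 * (2 * n + 1) * n.centralBinom := by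
        exact_mod_cast Nat.succ_mul_centralBinom_succ n
      rw [pow_succ]
      field_simp
      linarith
    rw [h, mul_pow]
    calc _ ≤ ((2 * n + 1) / (2 * (n + 1)) : ℝ) ^ 2 * (1 / (2 * n + 1)) := by gcongr
      _ ≤ _ := by
        push_cast
        rw [div_pow, div_mul_div_comm, div_le_div_iff₀ (by positivity) (by positivity)]
        have hn : (0 : ℝ) ≤ n := by positivity
        nlinarith

theorem tendsto_centralBinom_div_four_pow :
    Filter.Tendsto (fun n : ℕ => (n.centralBinom : ℝ) / 4 ^ n) Filter.atTop (nhds 0) := by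
  have h : Filter.Tendsto (fun n : ℕ => ((n.centralBinom : ℝ) / 4 ^ n) ^ 2)
      Filter.atTop (nhds 0) := by
    refine squeeze_zero (fun n => by positivity) (fun n => ?_)
      (tendsto_one_div_add_atTop_nhds_zero_nat (𝕜 := ℝ))
    refine (centralBinom_div_four_pow_sq_le n).trans ?_
    gcongr
    linarith [(Nat.cast_nonneg n : (0 : ℝ) ≤ n)]
  have h' := h.sqrt
  rw [Real.sqrt_zero] at h'
  exact h'.congr fun n => Real.sqrt_sq (by positivity)

theorem hasSum_catalan_div_four_pow : HasSum (fun n : ℕ => (catalan n : ℝ) / 4 ^ n) 2 := by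
  rw [hasSum_iff_tendsto_nat_of_nonneg (fun n => by positivity)]
  simp_rw [sum_range_catalan_div_four_pow]
  simpa using (tendsto_centralBinom_div_four_pow.const_mul 2).const_sub 2

theorem hasSum_catalan_div_four_pow_mul_pow {q : ℝ} (hq₀ : 0 ≤ q) (hq₁ : q ≤ 1) :
    HasSum (fun n : ℕ => (catalan n : ℝ) / 4 ^ n * q ^ n) (2 / (1 + √(1 - q))) := by
  set f : ℕ → ℝ := fun n => (catalan n : ℝ) / 4 ^ n * q ^ n with hf
  have hf₀ : ∀ n, 0 ≤ f n := fun n => by positivity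
  have hle : ∀ n, f n ≤ (catalan n : ℝ) / 4 ^ n := fun n =>
    mul_le_of_le_one_right (by positivity) (pow_le_one₀ hq₀ hq₁)
  have hs : Summable f := hasSum_catalan_div_four_pow.summable.of_nonneg_of_le hf₀ hle
  have hB₂ : ∑' n, f n ≤ 2 := hasSum_le hle hs.hasSum hasSum_catalan_div_four_pow
  have hB₀ : 0 ≤ ∑' n, f n := tsum_nonneg hf₀
  have hrec : ∀ n, f (n + 1) = q / 4 * ∑ kl ∈ Finset.HasAntidiagonal.antidiagonal n, f kl.1 * f kl.2 := by
    intro n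
    simp only [hf, catalan_succ', Nat.cast_sum, Nat.cast_mul, Finset.sum_div, Finset.sum_mul,
      Finset.mul_sum]
    refine Finset.sum_congr rfl fun kl hkl => ?_
    rw [← Finset.HasAntidiagonal.mem_antidiagonal.mp hkl]
    simp only [pow_succ, pow_add]
    field_simp
  have hquad : ∑' n, f n = 1 + q / 4 * (∑' n, f n) ^ 2 := by
    rw [sq, tsum_mul_tsum_eq_tsum_sum_antidiagonal_of_summable_norm hs.norm hs.norm,
      ← tsum_mul_left, hs.tsum_eq_zero_add]
    simp_rw [hrec]
    simp [hf]
  convert hs.hasSum using 1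
  generalize ∑' n, f n = B at *
  have hsq : √(1 - q) = 1 - q * B / 2 := by
    rw [Real.sqrt_eq_iff_mul_self_eq (by linarith) (by nlinarith)]
    linear_combination q * hquad
  have hpos : 0 < 1 + √(1 - q) := by positivity
  rw [div_eq_iff hpos.ne', hsq]
  linear_combination -2 * hquad

/-- Expansion of `f(p) = 2√p/(1+√p)` as `1 - ∑_{k≥1} c_k (1-p)^k` with
`c_k = 2 c'_{k+1}`, nonnegative coefficients summing to 1. Coefficients are
indexed from 0: `c n` denotes the paper's `c_{n+1} = 2 c'_{n+2}`. -/
theorem stmt12 (p : ℝ) (hp : p ∈ Set.Ioo (0 : ℝ) 1) :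
    (∀ n : ℕ, 0 ≤ 2 * sqrtCoeff (n + 2)) ∧
    HasSum (fun n : ℕ => 2 * sqrtCoeff (n + 2) * (1 - p) ^ (n + 1))
      (1 - 2 * Real.sqrt p / (1 + Real.sqrt p)) ∧
    HasSum (fun n : ℕ => 2 * sqrtCoeff (n + 2)) 1 := by
  obtain ⟨hp₀, hp₁⟩ := hp
  simp_rw [sqrtCoeff_succ]
  refine ⟨fun n => by positivity, ?_, ?_⟩
  · have h := hasSum_catalan_div_four_pow_mul_pow (q := 1 - p) (by linarith) (by linarith)
    rw [sub_sub_cancel, ← hasSum_nat_add_iff' 1] at h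
    refine (congrArg (HasSum _) ?_).mp h
    have hpos : 0 < 1 + √p := by positivity
    simp only [Finset.sum_range_one, catalan_zero, Nat.cast_one, pow_zero, div_one, mul_one]
    field_simp
    ring
  · have h := hasSum_catalan_div_four_pow
    rw [← hasSum_nat_add_iff' 1] at h
    norm_num at h
    exact h
end

section
/- For every p ∈ (0,1), log₂(1 + √p) = 1 - ∑_{k=1}^∞ c_k (1-p)^k, where c_k = binomial(2k, k) / (2^{2k+1} k log 2). Moreover all c_k are nonnegative and ∑_{k=1}^∞ c_k = 1. -/
theorem multichoose_half_eq_centralBinom_div (n : ℕ) :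
    Ring.multichoose (1 / 2 : ℝ) n = (Nat.centralBinom n : ℝ) / 4 ^ n := by
  have eval_eq : ∀ m : ℕ, (ascPochhammer ℝ m).eval (1 / 2) =
      (m.factorial : ℝ) * ((Nat.centralBinom m : ℝ) / 4 ^ m) := by
    intro m
    induction m with
    | zero => simp
    | succ k ih =>
      rw [ascPochhammer_succ_eval, ih, Nat.factorial_succ]
      have h : ((k : ℝ) + 1) * (Nat.centralBinom (k + 1) : ℝ) =
          2 * (2 * k + 1) * Nat.centralBinom k := by
        exact_mod_cast Nat.succ_mul_centralBinom_succ k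
      push_cast
      rw [pow_succ]
      field_simp
      linear_combination (-2 : ℝ) * h
  have h := Ring.factorial_nsmul_multichoose_eq_ascPochhammer (1 / 2 : ℝ) n
  rw [Polynomial.ascPochhammer_smeval_eq_eval, eval_eq, nsmul_eq_mul] at h
  exact mul_left_cancel₀ (by exact_mod_cast n.factorial_ne_zero) h

theorem hasSum_centralBinom_div_four_pow_mul_pow {x : ℝ} (hx : |x| < 1) :
    HasSum (fun n : ℕ => (Nat.centralBinom n : ℝ) / 4 ^ n * x ^ n) (1 / √(1 - x)) := by
  have h := (Real.one_div_one_sub_rpow_hasFPowerSeriesOnBall_zero (1 / 2)).hasSum (y := x)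
    (by simpa [enorm_eq_nnnorm, ← NNReal.coe_lt_coe] using hx)
  rw [zero_add, ← Real.sqrt_eq_rpow] at h
  convert! h using 2 with n
  rw [← multichoose_half_eq_centralBinom_div]
  have hn : (1 / 2 : ℝ) + n - 1 - n + 1 = 1 / 2 := by ring
  simp [FormalMultilinearSeries.ofScalars, Ring.choose, hn, mul_comm, -one_div]

theorem summable_centralBinom_succ_integrated {x : ℝ} (hx : |x| < 1) :
    Summable fun n : ℕ =>
      (Nat.centralBinom (n + 1) : ℝ) / 4 ^ (n + 1) / (2 * (n + 1)) * x ^ (n + 1) := by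
  have h := ((summable_nat_add_iff 1).2 (hasSum_centralBinom_div_four_pow_mul_pow hx).summable).abs
  refine Summable.of_norm_bounded h fun n => ?_
  rw [Real.norm_eq_abs, abs_mul, abs_mul]
  refine mul_le_mul_of_nonneg_right ?_ (abs_nonneg _)
  rw [abs_of_nonneg (by positivity), abs_of_nonneg (by positivity)]
  apply div_le_self (by positivity)
  have : (0 : ℝ) ≤ n := by positivity
  linarith

theorem hasDerivAt_tsum_centralBinom_succ_integrated {x : ℝ} (hx : |x| < 1) :
    HasDerivAt (fun y : ℝ => ∑' n : ℕ,
        (Nat.centralBinom (n + 1) : ℝ) / 4 ^ (n + 1) / (2 * (n + 1)) * y ^ (n + 1))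
      (∑' n : ℕ, (Nat.centralBinom (n + 1) : ℝ) / 4 ^ (n + 1) / 2 * x ^ n) x := by
  obtain ⟨r, hxr, hr⟩ := exists_between hx
  have hr0 : 0 < r := (abs_nonneg x).trans_lt hxr
  refine hasDerivAt_tsum_of_isPreconnected (u := fun n : ℕ => r ^ n)
    (g := fun (n : ℕ) (y : ℝ) =>
      (Nat.centralBinom (n + 1) : ℝ) / 4 ^ (n + 1) / (2 * (n + 1)) * y ^ (n + 1))
    (g' := fun (n : ℕ) (y : ℝ) => (Nat.centralBinom (n + 1) : ℝ) / 4 ^ (n + 1) / 2 * y ^ n)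
    (t := Set.Ioo (-r) r) (y₀ := 0)
    (summable_geometric_of_lt_one hr0.le hr) isOpen_Ioo isPreconnected_Ioo ?_ ?_
    ⟨by linarith, hr0⟩ ?_ (abs_lt.1 hxr)
  · intro n y _
    have h := (hasDerivAt_pow (n + 1) y).const_mul
      ((Nat.centralBinom (n + 1) : ℝ) / 4 ^ (n + 1) / (2 * (n + 1)))
    refine h.congr_deriv ?_
    have : (n : ℝ) + 1 ≠ 0 := by positivity
    push_cast
    field_simp
  · intro n y hy
    have hb : (Nat.centralBinom (n + 1) : ℝ) / 4 ^ (n + 1) ≤ 1 := by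
      rw [div_le_one (by positivity)]
      exact_mod_cast Nat.centralBinom_le_four_pow (n + 1)
    have hb0 : 0 ≤ (Nat.centralBinom (n + 1) : ℝ) / 4 ^ (n + 1) := by positivity
    rw [Real.norm_eq_abs, abs_mul, abs_pow, abs_of_nonneg (by positivity)]
    calc _ ≤ 1 * r ^ n := by
          gcongr
          · linarith
          · exact (abs_lt.2 hy).le
      _ = r ^ n := one_mul _
  · simp

theorem hasDerivAt_neg_log_one_add_sqrt_one_sub {x : ℝ} (hx : x < 1) :
    HasDerivAt (fun y : ℝ => -Real.log (1 + √(1 - y)))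
      (1 / (2 * √(1 - x) * (1 + √(1 - x)))) x := by
  have hs : 0 < √(1 - x) := Real.sqrt_pos.2 (by linarith)
  have h := ((((hasDerivAt_id x).const_sub 1).sqrt (by simp; linarith)).const_add 1).log
    (by positivity)
  refine h.neg.congr_deriv ?_
  simp only [id]
  field_simp

theorem tsum_centralBinom_succ_mul_pow {x : ℝ} (hx : |x| < 1) :
    ∑' n : ℕ, (Nat.centralBinom (n + 1) : ℝ) / 4 ^ (n + 1) / 2 * x ^ n =
      1 / (2 * √(1 - x) * (1 + √(1 - x))) := by
  rcases eq_or_ne x 0 with rfl | hx0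
  · rw [tsum_eq_single 0 (by intro n hn; simp [hn])]
    norm_num [Nat.centralBinom]
  · have h := (hasSum_nat_add_iff' 1).2 (hasSum_centralBinom_div_four_pow_mul_pow hx)
    have hsum := (h.mul_left (1 / (2 * x))).tsum_eq
    have hs : 0 < √(1 - x) := Real.sqrt_pos.2 (by linarith [abs_lt.1 hx])
    have hsq : √(1 - x) ^ 2 = 1 - x := Real.sq_sqrt (by linarith [abs_lt.1 hx])
    trans 1 / (2 * x) * (1 / √(1 - x) - 1)
    · rw [← show _ = 1 / (2 * x) * (1 / √(1 - x) - 1) by simpa using hsum]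
      refine tsum_congr fun n => ?_
      rw [pow_succ x n]
      field_simp
    · field_simp
      linear_combination -hsq

theorem hasSum_centralBinom_succ_integrated {x : ℝ} (hx : |x| < 1) :
    HasSum (fun n : ℕ =>
        (Nat.centralBinom (n + 1) : ℝ) / 4 ^ (n + 1) / (2 * (n + 1)) * x ^ (n + 1))
      (Real.log 2 - Real.log (1 + √(1 - x))) := by
  set F : ℝ → ℝ := fun y => ∑' n : ℕ,
    (Nat.centralBinom (n + 1) : ℝ) / 4 ^ (n + 1) / (2 * (n + 1)) * y ^ (n + 1) with hF
  have hderiv : ∀ y ∈ Set.Ioo (-1 : ℝ) 1,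
      HasDerivAt (fun z => F z - -Real.log (1 + √(1 - z))) 0 y := by
    intro y hy
    have hy' : |y| < 1 := abs_lt.2 hy
    have h := (hasDerivAt_tsum_centralBinom_succ_integrated hy').sub
      (hasDerivAt_neg_log_one_add_sqrt_one_sub hy.2)
    rwa [tsum_centralBinom_succ_mul_pow hy', sub_self] at h
  have hconst := isOpen_Ioo.is_const_of_deriv_eq_zero isPreconnected_Ioo
    (fun y hy => (hderiv y hy).differentiableAt.differentiableWithinAt)
    (fun y hy => (hderiv y hy).deriv) (abs_lt.1 hx)
    (show (0 : ℝ) ∈ Set.Ioo (-1 : ℝ) 1 by norm_num)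
  have hF0 : F 0 = 0 := by simp [hF]
  have h2 : Real.log (1 + √(1 - 0)) = Real.log 2 := by norm_num
  simp only [hF0, h2] at hconst
  have hval : F x = Real.log 2 - Real.log (1 + √(1 - x)) := by linarith
  exact hval ▸ (summable_centralBinom_succ_integrated hx).hasSum

theorem hasSum_choose_logb_one_add_sqrt {p : ℝ} (hp : p ∈ Set.Ioo (0 : ℝ) 1) :
    HasSum (fun n : ℕ => (Nat.choose (2 * (n + 1)) (n + 1) : ℝ) /
        (2 ^ (2 * (n + 1) + 1) * (n + 1) * Real.log 2) * (1 - p) ^ (n + 1))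
      (1 - Real.logb 2 (1 + Real.sqrt p)) := by
  have hlog : Real.log 2 ≠ 0 := (Real.log_pos one_lt_two).ne'
  have h := (hasSum_centralBinom_succ_integrated (x := 1 - p)
    (abs_lt.2 ⟨by linarith [hp.2], by linarith [hp.1]⟩)).div_const (Real.log 2)
  rw [sub_sub_cancel, sub_div, div_self hlog] at h
  refine h.congr_fun fun n => ?_
  rw [Nat.centralBinom, pow_succ 2 (2 * (n + 1)), pow_mul]
  norm_num
  field_simp

/-- Monotone Abel summation: a nonnegative series whose power series has a left limit at `1`
sums to that limit. -/
theorem hasSum_of_hasSum_mul_pow_of_tendsto {c : ℕ → ℝ} (hc : ∀ n, 0 ≤ c n) {f : ℝ → ℝ} {a : ℝ}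
    (hf : ∀ x ∈ Set.Ioo (0 : ℝ) 1, HasSum (fun n => c n * x ^ (n + 1)) (f x))
    (hlim : Filter.Tendsto f (nhdsWithin 1 (Set.Iio 1)) (nhds a)) : HasSum c a := by
  have hmem : ∀ᶠ x in nhdsWithin (1 : ℝ) (Set.Iio 1), x ∈ Set.Ioo (0 : ℝ) 1 :=
    Ioo_mem_nhdsLT one_pos
  have hpartial : ∀ N : ℕ, ∑ n ∈ Finset.range N, c n ≤ a := by
    intro N
    have hcont : Continuous fun x : ℝ => ∑ n ∈ Finset.range N, c n * x ^ (n + 1) := by fun_prop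
    have htend := (hcont.tendsto 1).mono_left (nhdsWithin_le_nhds (s := Set.Iio 1))
    simp only [one_pow, mul_one] at htend
    refine le_of_tendsto_of_tendsto htend hlim ?_
    filter_upwards [hmem] with x hx
    exact sum_le_hasSum _ (fun n _ => mul_nonneg (hc n) (pow_nonneg hx.1.le _)) (hf x hx)
  have hsum : Summable c := summable_of_sum_range_le hc hpartial
  have hle : ∑' n, c n ≤ a := hsum.tsum_le_of_sum_range_le hpartial
  have hge : a ≤ ∑' n, c n := by
    refine le_of_tendsto hlim ?_
    filter_upwards [hmem] with x hx
    exact hasSum_le (fun n => mul_le_of_le_one_right (hc n) (pow_le_one₀ hx.1.le hx.2.le))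
      (hf x hx) hsum.hasSum
  exact hle.antisymm hge ▸ hsum.hasSum

/-- Expansion of `f(p) = log₂(1+√p)` as `1 - ∑_{k≥1} c_k (1-p)^k` with
`c_k = C(2k,k)/(2^{2k+1} k log 2)`, nonnegative coefficients summing to 1.
Coefficients are indexed from 0: `c n` denotes the paper's `c_{n+1}`, i.e.
`c n = C(2(n+1), n+1) / (2^{2(n+1)+1} (n+1) log 2)`. -/
theorem stmt13 (p : ℝ) (hp : p ∈ Set.Ioo (0 : ℝ) 1) :
    (∀ n : ℕ, 0 ≤ (Nat.choose (2 * (n + 1)) (n + 1) : ℝ) /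
        (2 ^ (2 * (n + 1) + 1) * (n + 1) * Real.log 2)) ∧
    HasSum (fun n : ℕ => (Nat.choose (2 * (n + 1)) (n + 1) : ℝ) /
        (2 ^ (2 * (n + 1) + 1) * (n + 1) * Real.log 2) * (1 - p) ^ (n + 1))
      (1 - Real.logb 2 (1 + Real.sqrt p)) ∧
    HasSum (fun n : ℕ => (Nat.choose (2 * (n + 1)) (n + 1) : ℝ) /
        (2 ^ (2 * (n + 1) + 1) * (n + 1) * Real.log 2)) 1 := by
  have hnonneg : ∀ n : ℕ, 0 ≤ (Nat.choose (2 * (n + 1)) (n + 1) : ℝ) /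
      (2 ^ (2 * (n + 1) + 1) * (n + 1) * Real.log 2) := by
    intro n
    have := Real.log_pos one_lt_two
    positivity
  refine ⟨hnonneg, hasSum_choose_logb_one_add_sqrt hp,
    hasSum_of_hasSum_mul_pow_of_tendsto hnonneg
      (f := fun x => 1 - Real.logb 2 (1 + √(1 - x))) (fun x hx => ?_) ?_⟩
  · simpa using hasSum_choose_logb_one_add_sqrt (p := 1 - x)
      ⟨by linarith [hx.2], by linarith [hx.1]⟩
  · have hcont : ContinuousAt (fun x : ℝ => 1 - Real.log (1 + √(1 - x)) / Real.log 2) 1 := by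
      have : (1 : ℝ) + √(1 - 1) ≠ 0 := by simp
      fun_prop (disch := assumption)
    have h := hcont.tendsto.mono_left (nhdsWithin_le_nhds (s := Set.Iio 1))
    simpa [Real.logb] using h
end

section
/- Let (y_j)_{j≥-1} be the sequence of values of the Bessel polynomials at 1, defined by y_{-1} = y_0 = 1 and y_j = (2j-1) y_{j-1} + y_{j-2} for j ≥ 1. Then for every p ∈ (0,1), e^{1-√(1-p)} = 1 + ∑_{k=1}^∞ (y_{k-1} / (2^k · k!)) p^k. -/
open Complex in
/-- The principal branch of `√(1 - z)`. -/
noncomputable def sqrtOneSub (z : ℂ) : ℂ := exp (log (1 - z) / 2)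

lemma one_sub_mem_slitPlane {z : ℂ} (hz : z ∈ Metric.ball (0 : ℂ) 1) :
    1 - z ∈ Complex.slitPlane := by
  rw [mem_ball_zero_iff] at hz
  left
  have := (Complex.re_le_norm z).trans_lt hz
  simpa using this

lemma sqrtOneSub_ne_zero (z : ℂ) : sqrtOneSub z ≠ 0 := Complex.exp_ne_zero _

lemma sqrtOneSub_sq {z : ℂ} (hz : z ≠ 1) : sqrtOneSub z ^ 2 = 1 - z := by
  rw [sqrtOneSub, ← Complex.exp_nat_mul, Nat.cast_ofNat, mul_div_cancel₀ _ two_ne_zero,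
    Complex.exp_log (sub_ne_zero.mpr hz.symm)]

lemma sqrtOneSub_zero : sqrtOneSub 0 = 1 := by simp [sqrtOneSub]

lemma sqrtOneSub_ofReal {p : ℝ} (hp : p < 1) : sqrtOneSub p = (√(1 - p) : ℝ) := by
  have h : 0 < 1 - p := sub_pos.mpr hp
  rw [sqrtOneSub, ← Complex.ofReal_one, ← Complex.ofReal_sub, ← Complex.ofReal_log h.le,
    Real.sqrt_eq_rpow, Real.rpow_def_of_pos h]
  push_cast
  ring_nf

lemma ne_one_of_mem_ball {z : ℂ} (hz : z ∈ Metric.ball (0 : ℂ) 1) : z ≠ 1 := by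
  rintro rfl
  simp at hz

lemma hasDerivAt_sqrtOneSub {z : ℂ} (hz : z ∈ Metric.ball (0 : ℂ) 1) :
    HasDerivAt sqrtOneSub (-1 / (2 * sqrtOneSub z)) z := by
  have h := ((((hasDerivAt_id z).const_sub 1).clog (one_sub_mem_slitPlane hz)).div_const 2).cexp
  refine h.congr_deriv ?_
  change sqrtOneSub z * (-1 / (1 - z) / 2) = _
  rw [← sqrtOneSub_sq (ne_one_of_mem_ball hz)]
  have := sqrtOneSub_ne_zero z
  field_simp

lemma hasDerivAt_exp_one_sub_sqrtOneSub {z : ℂ} (hz : z ∈ Metric.ball (0 : ℂ) 1) :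
    HasDerivAt (fun z => Complex.exp (1 - sqrtOneSub z))
      (Complex.exp (1 - sqrtOneSub z) / (2 * sqrtOneSub z)) z := by
  refine ((hasDerivAt_sqrtOneSub hz).const_sub 1).cexp.congr_deriv ?_
  ring

lemma deriv_deriv_exp_one_sub_sqrtOneSub {z : ℂ} (hz : z ∈ Metric.ball (0 : ℂ) 1) :
    4 * (1 - z) * deriv (deriv fun z => Complex.exp (1 - sqrtOneSub z)) z =
      Complex.exp (1 - sqrtOneSub z) + 2 * deriv (fun z => Complex.exp (1 - sqrtOneSub z)) z := by
  have hs := sqrtOneSub_ne_zero z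
  have heq : deriv (fun z => Complex.exp (1 - sqrtOneSub z)) =ᶠ[nhds z]
      fun z => Complex.exp (1 - sqrtOneSub z) / (2 * sqrtOneSub z) := by
    filter_upwards [Metric.isOpen_ball.mem_nhds hz] with w hw
    exact (hasDerivAt_exp_one_sub_sqrtOneSub hw).deriv
  have h := (hasDerivAt_exp_one_sub_sqrtOneSub hz).fun_div
    ((hasDerivAt_sqrtOneSub hz).const_mul 2) (mul_ne_zero two_ne_zero hs)
  rw [heq.deriv_eq, h.deriv, heq.eq_of_nhds, ← sqrtOneSub_sq (ne_one_of_mem_ball hz)]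
  field_simp
  ring

/-- Differentiating `4 (1 - z) f'' = f + 2 f'` repeatedly gives a three-term recurrence for the
iterated derivatives of `f`. -/
lemma iteratedDeriv_recurrence {f : ℂ → ℂ} {U : Set ℂ} (hU : IsOpen U)
    (hf : AnalyticOnNhd ℂ f U)
    (hode : ∀ z ∈ U, 4 * (1 - z) * deriv (deriv f) z = f z + 2 * deriv f z) (n : ℕ) :
    ∀ z ∈ U, 4 * (1 - z) * iteratedDeriv (n + 2) f z =
      iteratedDeriv n f z + (4 * n + 2) * iteratedDeriv (n + 1) f z := by
  have hd (k : ℕ) {z : ℂ} (hz : z ∈ U) :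
      HasDerivAt (iteratedDeriv k f) (iteratedDeriv (k + 1) f z) z := by
    rw [iteratedDeriv_succ, iteratedDeriv_eq_iterate]
    exact (hf.iterated_deriv k z hz).differentiableAt.hasDerivAt
  induction n with
  | zero => simpa [iteratedDeriv_succ] using hode
  | succ n ih =>
    intro z hz
    have hl := (((hasDerivAt_id z).const_sub 1).const_mul 4).mul (hd (n + 2) hz)
    have hr := (hd n hz).add ((hd (n + 1) hz).const_mul (4 * (n : ℂ) + 2))
    have key := hl.unique (hr.congr_of_eventuallyEq
      (Filter.eventuallyEq_of_mem (hU.mem_nhds hz) ih))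
    simp only [id_eq, Nat.add_assoc, Nat.reduceAdd] at key ⊢
    push_cast
    linear_combination key

lemma iteratedDeriv_exp_one_sub_sqrtOneSub_zero {y : ℕ → ℝ} (hy0 : y 0 = 1) (hy1 : y 1 = 1)
    (hyrec : ∀ m : ℕ, y (m + 2) = (2 * (m + 1) - 1) * y (m + 1) + y m) (n : ℕ) :
    iteratedDeriv n (fun z => Complex.exp (1 - sqrtOneSub z)) 0 = (y n / 2 ^ n : ℝ) := by
  have h0 : (0 : ℂ) ∈ Metric.ball (0 : ℂ) 1 := Metric.mem_ball_self one_pos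
  have hf : AnalyticOnNhd ℂ (fun z => Complex.exp (1 - sqrtOneSub z)) (Metric.ball 0 1) :=
    DifferentiableOn.analyticOnNhd (fun z hz =>
      (hasDerivAt_exp_one_sub_sqrtOneSub hz).differentiableAt.differentiableWithinAt)
      Metric.isOpen_ball
  induction n using Nat.twoStepInduction with
  | zero => simp [sqrtOneSub_zero, hy0]
  | one =>
    rw [iteratedDeriv_one, (hasDerivAt_exp_one_sub_sqrtOneSub h0).deriv]
    simp [sqrtOneSub_zero, hy1]
  | more n ih₀ ih₁ =>
    have h := iteratedDeriv_recurrence Metric.isOpen_ball hf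
      (fun z hz => deriv_deriv_exp_one_sub_sqrtOneSub hz) n 0 h0
    rw [ih₀, ih₁] at h
    rw [hyrec]
    push_cast at h ⊢
    rw [sub_zero, mul_one, mul_comm, ← eq_div_iff (by norm_num)] at h
    rw [h, pow_succ _ (n + 1), pow_succ _ n]
    field_simp
    ring


/-- Values of the Bessel polynomials at 1, expressed with a shifted index:
`y n` denotes the paper's `y_{n-1}`, so `y 0 = y_{-1} = 1`, `y 1 = y_0 = 1`,
and the recurrence `y_j = (2j-1) y_{j-1} + y_{j-2}` (for `j ≥ 1`) becomes
`y (m+2) = (2(m+1)-1) y (m+1) + y m`. Then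
`e^{1-√(1-p)} = 1 + ∑_{k≥1} (y_{k-1}/(2^k k!)) p^k` for `p ∈ (0,1)`,
stated with summation index `n = k-1`. -/
theorem stmt14 (y : ℕ → ℝ) (hy0 : y 0 = 1) (hy1 : y 1 = 1)
    (hyrec : ∀ m : ℕ, y (m + 2) = (2 * (m + 1) - 1) * y (m + 1) + y m)
    (p : ℝ) (hp : p ∈ Set.Ioo (0 : ℝ) 1) :
    HasSum (fun n : ℕ => y (n + 1) / (2 ^ (n + 1) * Nat.factorial (n + 1)) * p ^ (n + 1))
      (Real.exp (1 - Real.sqrt (1 - p)) - 1) := by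
  have hpn : (p : ℂ) ∈ Metric.ball (0 : ℂ) 1 := by
    rw [mem_ball_zero_iff, Complex.norm_real, Real.norm_of_nonneg hp.1.le]
    exact hp.2
  have h := Complex.hasSum_taylorSeries_on_ball (f := fun z => Complex.exp (1 - sqrtOneSub z))
    (fun z hz => (hasDerivAt_exp_one_sub_sqrtOneSub hz).differentiableAt.differentiableWithinAt) hpn
  simp only [iteratedDeriv_exp_one_sub_sqrtOneSub_zero hy0 hy1 hyrec, sqrtOneSub_ofReal hp.2,
    smul_eq_mul, sub_zero] at h
  have hreal : HasSum (fun n : ℕ => y n / (2 ^ n * Nat.factorial n) * p ^ n)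
      (Real.exp (1 - √(1 - p))) := by
    rw [← Complex.hasSum_ofReal]
    push_cast
    refine h.congr_fun fun n => ?_
    push_cast
    field_simp
  simpa [hy0] using (hasSum_nat_add_iff' 1).mpr hreal
end
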